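/- arXiv:1408.4208 — 3 statements merged into one kernel-verified Lean document; each statement's English description precedes it below -/
import Mathlib

section
/- The exceptional unimodular singularity S12, given by f = x^2·y + y^2·z + z^3·x in ℂ[x,y,z], is weighted homogeneous of weights (4,5,3) and degree 13; the origin is its only critical point in ℂ^3; and its Jacobian algebra Jac(f) = ℂ[x,y,z]/(∂f/∂x, ∂f/∂y, ∂f/∂z) has dimension 12 as a ℂ-vector space (Milnor number μ = 12). -/
open MvPolynomial

namespace S12

/-- The exponent table of the socle functional of the Jacobian algebra of `S12`. -/
noncomputable def socleCoeff (a b c : ℕ) : ℂ :=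
  if a = 1 ∧ b = 1 ∧ c = 2 then 1
  else if a = 0 ∧ b = 3 ∧ c = 0 then -3
  else if a = 3 ∧ b = 0 ∧ c = 1 then -2
  else if a = 0 ∧ b = 0 ∧ c = 5 then -2
  else 0

/-- The linear functional on `ℂ[x, y, z]` that vanishes on the Jacobian ideal of `S12` and takes
the value `1` at the socle generator `x y z²`. -/
noncomputable def socle : MvPolynomial (Fin 3) ℂ →ₗ[ℂ] ℂ :=
  (basisMonomials (Fin 3) ℂ).constr ℂ fun m => socleCoeff (m 0) (m 1) (m 2)

lemma socle_monomial (m : Fin 3 →₀ ℕ) :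
    socle (monomial m 1) = socleCoeff (m 0) (m 1) (m 2) := by
  have := (basisMonomials (Fin 3) ℂ).constr_basis ℂ
    (fun m : Fin 3 →₀ ℕ => socleCoeff (m 0) (m 1) (m 2)) m
  simpa [socle] using this

lemma monomial_mul_X_pow (m : Fin 3 →₀ ℕ) (a b c : ℕ) :
    (monomial m 1 : MvPolynomial (Fin 3) ℂ) * (X 0 ^ a * X 1 ^ b * X 2 ^ c) =
      monomial (m + (Finsupp.single 0 a + Finsupp.single 1 b + Finsupp.single 2 c)) 1 := by
  simp [X_pow_eq_monomial, monomial_mul]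

lemma socle_monomial_mul (m : Fin 3 →₀ ℕ) (a b c : ℕ) :
    socle (monomial m 1 * (X 0 ^ a * X 1 ^ b * X 2 ^ c)) =
      socleCoeff (m 0 + a) (m 1 + b) (m 2 + c) := by
  rw [monomial_mul_X_pow, socle_monomial]
  simp

lemma socle_X_pow (a b c : ℕ) :
    socle (X 0 ^ a * X 1 ^ b * X 2 ^ c) = socleCoeff a b c := by
  simpa using socle_monomial_mul 0 a b c

/-- A linear map vanishing on all monomial multiples of `p` vanishes on all multiples of `p`. -/
lemma map_mul_eq_zero_of_monomial {σ R M : Type*} [CommSemiring R] [AddCommMonoid M] [Module R M]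
    (φ : MvPolynomial σ R →ₗ[R] M) {p : MvPolynomial σ R}
    (h : ∀ m, φ (monomial m 1 * p) = 0) (q : MvPolynomial σ R) : φ (q * p) = 0 := by
  induction q using MvPolynomial.induction_on' with
  | monomial m r =>
    have : monomial m r * p = r • (monomial m 1 * p) := by
      rw [← smul_mul_assoc, smul_monomial, smul_eq_mul, mul_one]
    rw [this, map_smul, h, smul_zero]
  | add q₁ q₂ h₁ h₂ => rw [add_mul, map_add, h₁, h₂, add_zero]

/-- The three partial derivatives of `x² y + y² z + z³ x`. -/
noncomputable def grad : Fin 3 → MvPolynomial (Fin 3) ℂ :=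
  ![2 * (X 0 * X 1) + X 2 ^ 3, X 0 ^ 2 + 2 * (X 1 * X 2), X 1 ^ 2 + 3 * (X 0 * X 2 ^ 2)]

lemma pderiv_eq_grad (i : Fin 3) :
    pderiv i (X 0 ^ 2 * X 1 + X 1 ^ 2 * X 2 + X 2 ^ 3 * X 0 : MvPolynomial (Fin 3) ℂ) =
      grad i := by
  fin_cases i <;> simp [grad, pderiv_X] <;> ring

lemma socle_mul_grad (q : MvPolynomial (Fin 3) ℂ) (i : Fin 3) : socle (q * grad i) = 0 := by
  refine map_mul_eq_zero_of_monomial socle (fun m => ?_) q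
  have key : ∀ (r : ℂ) (a b c a' b' c' : ℕ),
      socle (monomial m 1 * (X 0 ^ a * X 1 ^ b * X 2 ^ c + C r * (X 0 ^ a' * X 1 ^ b' * X 2 ^ c')))
        = socleCoeff (m 0 + a) (m 1 + b) (m 2 + c)
          + r * socleCoeff (m 0 + a') (m 1 + b') (m 2 + c') := by
    intro r a b c a' b' c'
    rw [mul_add, ← smul_eq_C_mul, mul_smul_comm, map_add, map_smul, socle_monomial_mul,
      socle_monomial_mul, smul_eq_mul]
  fin_cases i
  · have := key 2 0 0 3 1 1 0
    simp only [map_ofNat, pow_zero, pow_one, one_mul, mul_one] at this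
    simp only [grad, Fin.zero_eta, Matrix.cons_val_zero]
    rw [add_comm (2 * _), this]
    simp only [socleCoeff]
    grind
  · have := key 2 2 0 0 0 1 1
    simp only [map_ofNat, pow_zero, pow_one, one_mul, mul_one] at this
    simp only [grad, Fin.mk_one, Matrix.cons_val_one, Matrix.cons_val_zero, this, socleCoeff]
    grind
  · have := key 3 0 2 0 1 0 2
    simp only [map_ofNat, pow_zero, pow_one, one_mul, mul_one] at this
    simp only [grad, Fin.reduceFinMk, Matrix.cons_val, this, socleCoeff]
    grind

lemma socle_eq_zero_of_mem {p : MvPolynomial (Fin 3) ℂ} (hp : p ∈ Ideal.span (Set.range grad)) :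
    socle p = 0 := by
  obtain ⟨c, rfl⟩ := Ideal.mem_span_range_iff_exists_fun.1 hp
  simp [socle_mul_grad]

/-- The monomials `x^a y^b z^c` with `a, b ≤ 1` and `c ≤ 2`. -/
def basisMonomial {A : Type*} [CommSemiring A] (x y z : A) (i : Fin 2 × Fin 2 × Fin 3) : A :=
  x ^ (i.1 : ℕ) * y ^ (i.2.1 : ℕ) * z ^ (i.2.2 : ℕ)

lemma socle_pairing (i j : Fin 2 × Fin 2 × Fin 3) :
    socle (basisMonomial (X 0) (X 1) (X 2) (j.1.rev, j.2.1.rev, j.2.2.rev) *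
      basisMonomial (X 0) (X 1) (X 2) i) = if i = j then 1 else 0 := by
  have : (basisMonomial (X 0) (X 1) (X 2) (j.1.rev, j.2.1.rev, j.2.2.rev) *
      basisMonomial (X 0) (X 1) (X 2) i : MvPolynomial (Fin 3) ℂ) =
      X 0 ^ ((j.1.rev : ℕ) + i.1) * X 1 ^ ((j.2.1.rev : ℕ) + i.2.1) *
        X 2 ^ ((j.2.2.rev : ℕ) + i.2.2) := by
    simp only [basisMonomial]
    ring
  rw [this, socle_X_pow]
  obtain ⟨a, b, c⟩ := i
  obtain ⟨a', b', c'⟩ := j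
  simp only [socleCoeff, Fin.val_rev, Prod.mk.injEq, Fin.ext_iff]
  grind

lemma linearIndependent_basisMonomial :
    LinearIndependent ℂ fun i => Ideal.Quotient.mk (Ideal.span (Set.range grad))
      (basisMonomial (X 0) (X 1) (X 2) i) := by
  rw [Fintype.linearIndependent_iff]
  intro g hg j
  have hmem : ∑ i, g i • basisMonomial (X 0) (X 1) (X 2) i ∈ Ideal.span (Set.range grad) := by
    rw [← Ideal.Quotient.eq_zero_iff_mem, ← hg, map_sum]
    rfl
  have h := socle_eq_zero_of_mem (Ideal.mul_mem_left _
    (basisMonomial (X 0) (X 1) (X 2) (j.1.rev, j.2.1.rev, j.2.2.rev)) hmem)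
  simpa [Finset.mul_sum, mul_smul_comm, socle_pairing] using h

section Span

variable {A : Type*} [CommRing A] [Algebra ℂ A] {x y z : A}

lemma eq_zero_of_thirteen_mul {a : A} (h : 13 * a = 0) : a = 0 := by
  have h' : (13 : ℂ) • a = 0 := by rw [Algebra.smul_def, map_ofNat, h]
  exact (smul_eq_zero_iff_right (by norm_num)).1 h'

lemma mul_basisMonomial_mem_span (hx : 2 * (x * y) + z ^ 3 = 0) (hy : x ^ 2 + 2 * (y * z) = 0)
    (hz : y ^ 2 + 3 * (x * z ^ 2) = 0) (i : Fin 2 × Fin 2 × Fin 3) :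
    x * basisMonomial x y z i ∈ Submodule.span ℂ (Set.range (basisMonomial x y z)) ∧
    y * basisMonomial x y z i ∈ Submodule.span ℂ (Set.range (basisMonomial x y z)) ∧
    z * basisMonomial x y z i ∈ Submodule.span ℂ (Set.range (basisMonomial x y z)) := by
  have hxxy : x ^ 2 * y = 0 := eq_zero_of_thirteen_mul (by
    linear_combination y * hy - 2 * z * hz + 6 * x * hx)
  have hyyz : y ^ 2 * z = 0 := by
    refine eq_zero_of_thirteen_mul ?_
    linear_combination z * hz - 3 * x * hx + 6 * y * hy
  have hxzzz : x * z ^ 3 = 0 := by linear_combination x * hx - 2 * hxxy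
  have hxxzz : x ^ 2 * z ^ 2 = 0 := eq_zero_of_thirteen_mul (by
    linear_combination z ^ 2 * hy - 2 * y * hx + 4 * x * hz)
  have hxyy : x * y ^ 2 = 0 := by linear_combination x * hz - 3 * hxxzz
  have hyzzz : y * z ^ 3 = 0 := by linear_combination y * hx - 2 * hxyy
  have mem : ∀ (r : ℂ) (j : Fin 2 × Fin 2 × Fin 3) (p : A),
      p = algebraMap ℂ A r * basisMonomial x y z j →
      p ∈ Submodule.span ℂ (Set.range (basisMonomial x y z)) := by
    rintro r j p rfl
    rw [← Algebra.smul_def]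
    exact Submodule.smul_mem _ _ (Submodule.subset_span ⟨j, rfl⟩)
  have mem_zero : ∀ p : A, p = 0 → p ∈ Submodule.span ℂ (Set.range (basisMonomial x y z)) := by
    rintro p rfl
    exact Submodule.zero_mem _
  obtain ⟨a, b, c⟩ := i
  refine ⟨?_, ?_, ?_⟩
  · fin_cases a
    · exact mem 1 (1, b, c) _ (by simp [basisMonomial]; ring)
    · fin_cases b
      · fin_cases c
        · exact mem (-2) (0, 1, 1) _ (by simp [basisMonomial, map_ofNat (algebraMap ℂ A)]; linear_combination hy)
        · exact mem (-2) (0, 1, 2) _ (by simp [basisMonomial, map_ofNat (algebraMap ℂ A)]; linear_combination z * hy)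
        · exact mem_zero _ (by simp [basisMonomial]; linear_combination hxxzz)
      · exact mem_zero _ (by simp [basisMonomial]; linear_combination z ^ (c : ℕ) * hxxy)
  · fin_cases b
    · exact mem 1 (a, 1, c) _ (by simp [basisMonomial]; ring)
    · fin_cases a
      · fin_cases c
        · exact mem (-3) (1, 0, 2) _ (by simp [basisMonomial, map_ofNat (algebraMap ℂ A)]; linear_combination hz)
        · exact mem_zero _ (by simp [basisMonomial]; linear_combination hyyz)
        · exact mem_zero _ (by simp [basisMonomial]; linear_combination z * hyyz)
      · exact mem_zero _ (by simp [basisMonomial]; linear_combination z ^ (c : ℕ) * hxyy)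
  · fin_cases c
    · exact mem 1 (a, b, 1) _ (by simp [basisMonomial]; ring)
    · exact mem 1 (a, b, 2) _ (by simp [basisMonomial]; ring)
    · fin_cases a
      · fin_cases b
        · exact mem (-2) (1, 1, 0) _ (by simp [basisMonomial, map_ofNat (algebraMap ℂ A)]; linear_combination hx)
        · exact mem_zero _ (by simp [basisMonomial]; linear_combination hyzzz)
      · exact mem_zero _ (by simp [basisMonomial]; linear_combination y ^ (b : ℕ) * hxzzz)

lemma aeval_mem_span_basisMonomial (hx : 2 * (x * y) + z ^ 3 = 0)
    (hy : x ^ 2 + 2 * (y * z) = 0) (hz : y ^ 2 + 3 * (x * z ^ 2) = 0)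
    (p : MvPolynomial (Fin 3) ℂ) :
    aeval ![x, y, z] p ∈ Submodule.span ℂ (Set.range (basisMonomial x y z)) := by
  have closed : ∀ w : A, (∀ i, w * basisMonomial x y z i ∈
        Submodule.span ℂ (Set.range (basisMonomial x y z))) →
      ∀ a ∈ Submodule.span ℂ (Set.range (basisMonomial x y z)),
        a * w ∈ Submodule.span ℂ (Set.range (basisMonomial x y z)) := by
    intro w hw a ha
    induction ha using Submodule.span_induction with
    | mem a ha =>
      obtain ⟨i, rfl⟩ := ha
      rw [mul_comm]
      exact hw i
    | zero => simp
    | add a b _ _ ha hb => rw [add_mul]; exact add_mem ha hb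
    | smul r a _ ha => rw [smul_mul_assoc]; exact Submodule.smul_mem _ r ha
  have hmul := mul_basisMonomial_mem_span hx hy hz
  induction p using MvPolynomial.induction_on with
  | C r =>
    rw [algHom_C, Algebra.algebraMap_eq_smul_one]
    exact Submodule.smul_mem _ r (Submodule.subset_span ⟨(0, 0, 0), by simp [basisMonomial]⟩)
  | add p q hp hq => rw [map_add]; exact add_mem hp hq
  | mul_X p i hp =>
    rw [map_mul, aeval_X]
    refine closed _ (fun j => ?_) _ hp
    fin_cases i
    · exact (hmul j).1
    · exact (hmul j).2.1
    · exact (hmul j).2.2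

end Span

lemma span_basisMonomial_eq_top :
    Submodule.span ℂ (Set.range fun i => Ideal.Quotient.mk (Ideal.span (Set.range grad))
      (basisMonomial (X 0) (X 1) (X 2) i)) = ⊤ := by
  set π := Ideal.Quotient.mkₐ ℂ (Ideal.span (Set.range grad))
  have hπ : ∀ i, π (grad i) = 0 := fun i =>
    Ideal.Quotient.eq_zero_iff_mem.2 (Ideal.subset_span ⟨i, rfl⟩)
  have hbasis : (fun i => Ideal.Quotient.mk (Ideal.span (Set.range grad))
      (basisMonomial (X 0) (X 1) (X 2) i)) = basisMonomial (π (X 0)) (π (X 1)) (π (X 2)) := by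
    ext i
    change π _ = _
    simp [basisMonomial]
  have hcomp : aeval ![π (X 0), π (X 1), π (X 2)] = π := by
    ext i
    fin_cases i <;> simp
  rw [hbasis, eq_top_iff]
  intro a _
  obtain ⟨p, rfl⟩ := Ideal.Quotient.mkₐ_surjective ℂ (Ideal.span (Set.range grad)) a
  change π p ∈ _
  rw [← DFunLike.congr_fun hcomp p]
  refine aeval_mem_span_basisMonomial ?_ ?_ ?_ p
  · have h : π (2 * (X 0 * X 1) + X 2 ^ 3) = 0 := hπ 0
    simpa only [map_add, map_mul, map_pow, map_ofNat] using h
  · have h : π (X 0 ^ 2 + 2 * (X 1 * X 2)) = 0 := hπ 1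
    simpa only [map_add, map_mul, map_pow, map_ofNat] using h
  · have h : π (X 1 ^ 2 + 3 * (X 0 * X 2 ^ 2)) = 0 := hπ 2
    simpa only [map_add, map_mul, map_pow, map_ofNat] using h

lemma finrank_quotient_grad :
    Module.finrank ℂ (MvPolynomial (Fin 3) ℂ ⧸ Ideal.span (Set.range grad)) = 12 := by
  have h := finrank_span_eq_card linearIndependent_basisMonomial
  rw [span_basisMonomial_eq_top, finrank_top] at h
  simpa using h

lemma eq_zero_of_eval_grad {v : Fin 3 → ℂ} (h : ∀ i, eval v (grad i) = 0) : v = 0 := by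
  have hx : 2 * (v 0 * v 1) + v 2 ^ 3 = 0 := by simpa [grad] using h 0
  have hy : v 0 ^ 2 + 2 * (v 1 * v 2) = 0 := by simpa [grad] using h 1
  have hz : v 1 ^ 2 + 3 * (v 0 * v 2 ^ 2) = 0 := by simpa [grad] using h 2
  have hxxy : v 0 ^ 2 * v 1 = 0 := by
    linear_combination (v 1 * hy - 2 * v 2 * hz + 6 * v 0 * hx) / 13
  have hxy : v 0 * v 1 = 0 := by
    rcases mul_eq_zero.1 hxxy with h0 | h1
    · rw [eq_zero_of_pow_eq_zero h0, zero_mul]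
    · rw [h1, mul_zero]
  have h2 : v 2 = 0 := by
    refine eq_zero_of_pow_eq_zero (n := 3) ?_
    linear_combination hx - 2 * hxy
  have h0 : v 0 = 0 := by simpa [h2] using hy
  have h1 : v 1 = 0 := by simpa [h2] using hz
  ext i
  fin_cases i <;> simp [h0, h1, h2]

end S12

/-- The exceptional unimodular singularity `S12`: `f = x²·y + y²·z + z³·x` is weighted
homogeneous of weights `(4, 5, 3)` and degree `13`, the origin is its only critical
point in `ℂ^3`, and its Jacobian algebra has dimension `12` over `ℂ`
(Milnor number `μ = 12`). -/
theorem S12_singularity :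
    ∀ f : MvPolynomial (Fin 3) ℂ, f = X 0 ^ 2 * X 1 + X 1 ^ 2 * X 2 + X 2 ^ 3 * X 0 →
    (∀ l : ℂ, aeval (fun i : Fin 3 => C (l ^ (![4, 5, 3] i : ℕ)) * X i) f = C (l ^ 13) * f) ∧
    (∀ v : Fin 3 → ℂ, (∀ i : Fin 3, eval v (pderiv i f) = 0) → v = 0) ∧
    Module.finrank ℂ
      (MvPolynomial (Fin 3) ℂ ⧸ Ideal.span (Set.range fun i : Fin 3 => pderiv i f)) = 12 := by
  rintro f rfl
  rw [funext S12.pderiv_eq_grad]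
  refine ⟨fun l => ?_, fun v hv => S12.eq_zero_of_eval_grad fun i => ?_,
    S12.finrank_quotient_grad⟩
  swap
  · rw [← S12.pderiv_eq_grad]
    exact hv i
  simp only [map_add, map_mul, map_pow, aeval_X, Matrix.cons_val]
  ring
end

section
/- Uniqueness of normalized weights (Saito): let f ∈ ℂ[x₁,…,xₙ] be a nonzero polynomial with f(0)=0 whose only critical point in ℂⁿ is the origin. Suppose q = (q₁,…,qₙ) and q′ = (q′₁,…,q′ₙ) are tuples of rational numbers with 0 < qᵢ ≤ 1/2 and 0 < q′ᵢ ≤ 1/2 for all i, such that every monomial x₁^{a₁}···xₙ^{aₙ} occurring with nonzero coefficient in f satisfies Σᵢ aᵢqᵢ = 1 and also Σᵢ aᵢq′ᵢ = 1 (i.e., f is quasi-homogeneous of total degree 1 with respect to both weight systems). Then q = q′. -/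
open MvPolynomial

/-- If `∂f/∂xⱼ` does not vanish at the `i`-th unit vector, then `f` contains a monomial
of the form `xᵢ ^ m * xⱼ`. -/
theorem exists_single_add_single_mem_support {σ R : Type*} [DecidableEq σ] [CommSemiring R]
    (f : MvPolynomial σ R) (i j : σ)
    (h : eval (Pi.single i 1 : σ → R) (pderiv j f) ≠ 0) :
    ∃ m : ℕ, Finsupp.single i m + Finsupp.single j 1 ∈ f.support := by
  rw [f.as_sum, map_sum, map_sum] at h
  obtain ⟨a, ha, hne⟩ := Finset.exists_ne_zero_of_sum_ne_zero h
  rw [pderiv_monomial, eval_monomial] at hne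
  have hj : a j ≠ 0 := fun h0 => hne (by simp [h0])
  obtain ⟨b, rfl⟩ : ∃ b, a = b + Finsupp.single j 1 :=
    ⟨_, (tsub_add_cancel_of_le
      (Finsupp.single_le_iff.mpr (Nat.one_le_iff_ne_zero.mpr hj))).symm⟩
  rw [add_tsub_cancel_right] at hne
  have hb : b = Finsupp.single i (b i) := by
    ext k
    by_cases hk : k = i
    · subst hk; simp
    rw [Finsupp.single_eq_of_ne hk]
    by_contra h0
    apply hne
    rw [Finsupp.prod, Finset.prod_eq_zero (Finsupp.mem_support_iff.mpr h0), mul_zero]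
    rw [Pi.single_eq_of_ne hk, zero_pow h0]
  exact ⟨b i, hb ▸ ha⟩

/-- Uniqueness of normalized weights (Saito): if a nonzero polynomial `f` over `ℂ`
with `f(0) = 0`, whose only critical point is the origin, is quasi-homogeneous of
total degree `1` with respect to two systems of rational weights all lying in
`(0, 1/2]`, then the two weight systems coincide. -/
theorem weights_unique (n : ℕ) (f : MvPolynomial (Fin n) ℂ)
    (hf0 : f ≠ 0) (hfz : constantCoeff f = 0)
    (hcrit : ∀ v : Fin n → ℂ, (∀ i : Fin n, eval v (pderiv i f) = 0) → v = 0)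
    (q q' : Fin n → ℚ)
    (hq : ∀ i, 0 < q i ∧ q i ≤ 1 / 2) (hq' : ∀ i, 0 < q' i ∧ q' i ≤ 1 / 2)
    (hwt : ∀ a ∈ f.support, ∑ i, (a i : ℚ) * q i = 1)
    (hwt' : ∀ a ∈ f.support, ∑ i, (a i : ℚ) * q' i = 1) :
    q = q' := by
  have hsum : ∀ (w : Fin n → ℚ) (i j : Fin n) (m : ℕ),
      ∑ k, ((Finsupp.single i m + Finsupp.single j 1 : Fin n →₀ ℕ) k : ℚ) * w k
        = m * w i + w j := by
    intro w i j m
    simp [Finsupp.single_apply, add_mul, Finset.sum_add_distrib]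
  funext k
  -- the index at which the two weight systems differ most
  obtain ⟨i, -, hi⟩ := Finset.exists_max_image Finset.univ (fun l => |q l - q' l|)
    ⟨k, Finset.mem_univ k⟩
  suffices h : q i - q' i = 0 by
    have hk := hi k (Finset.mem_univ k)
    rw [h, abs_zero, abs_nonpos_iff] at hk
    exact sub_eq_zero.mp hk
  obtain ⟨j, hj⟩ : ∃ j, eval (Pi.single i 1 : Fin n → ℂ) (pderiv j f) ≠ 0 := by
    by_contra! h
    simpa using congrFun (hcrit _ h) i
  obtain ⟨m, hm⟩ := exists_single_add_single_mem_support f i j hj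
  have h1 := hwt _ hm
  have h2 := hwt' _ hm
  rw [hsum] at h1 h2
  have hqi := hq i
  have hqj := hq j
  have hqi' := hq' i
  have hqj' := hq' j
  have hd : (m : ℚ) * (q i - q' i) = -(q j - q' j) := by linarith
  obtain rfl | rfl | hm2 : m = 0 ∨ m = 1 ∨ 2 ≤ m := by omega
  · norm_num at h1
    linarith
  · norm_num at h1 h2
    linarith
  · have habs : (m : ℚ) * |q i - q' i| = |q j - q' j| := by
      rw [← abs_neg (q j - q' j), ← hd, abs_mul, Nat.abs_cast]
    have hle := hi j (Finset.mem_univ j)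
    have hm2' : (2 : ℚ) ≤ m := by exact_mod_cast hm2
    rw [← abs_nonpos_iff]
    nlinarith [abs_nonneg (q i - q' i)]
end

section
/- Milnor number of a weighted homogeneous isolated singularity: let f ∈ ℂ[x₁,…,xₙ] be weighted homogeneous of positive integer weights (w₁,…,wₙ) and degree d with 0 < wᵢ < d for all i, and suppose the origin is the only critical point of f in ℂⁿ. Then the Jacobian algebra Jac(f) = ℂ[x₁,…,xₙ]/(∂f/∂x₁,…,∂f/∂xₙ) is finite-dimensional over ℂ of dimension equal to the product over i of (d − wᵢ)/wᵢ; equivalently, writing qᵢ = wᵢ/d, the Milnor number is μ = Πᵢ (1/qᵢ − 1). -/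
open MvPolynomial

/-- `l` is a weakly regular sequence on `R ⧸ J`, phrased in terms of ideals of `R`. -/
def Ideal.RegularMod {R : Type*} [CommRing R] : Ideal R → List R → Prop
  | _, [] => True
  | J, a :: l => (∀ x, a * x ∈ J → x ∈ J) ∧ Ideal.RegularMod (J ⊔ Ideal.span {a}) l

namespace Ideal.RegularMod

variable {R : Type*} [CommRing R]

theorem append_iff {J : Ideal R} {l l' : List R} :
    J.RegularMod (l ++ l') ↔ J.RegularMod l ∧ (J ⊔ Ideal.ofList l).RegularMod l' := by
  induction l generalizing J with
  | nil => simp [Ideal.RegularMod]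
  | cons a l ih =>
    simp [Ideal.RegularMod, ih, and_assoc, Ideal.ofList_cons, sup_assoc]

/-- If `b` lies in the radical of `J + (l) + (c)` and `l, b` is regular modulo `J`, then so is
`l, c`. -/
theorem exchange_last {J : Ideal R} {l : List R} {b c : R}
    (hb : b ∈ (J ⊔ Ideal.ofList l ⊔ Ideal.span {c}).radical)
    (h : J.RegularMod (l ++ [b])) : J.RegularMod (l ++ [c]) := by
  rw [append_iff] at h ⊢
  refine ⟨h.1, fun u hu => ?_, trivial⟩
  obtain ⟨N, hN⟩ := hb
  obtain ⟨k, hk, y, hy, hky⟩ := Submodule.mem_sup.mp hN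
  obtain ⟨t, rfl⟩ := Ideal.mem_span_singleton'.mp hy
  have key : b ^ N * u ∈ J ⊔ Ideal.ofList l := by
    rw [← hky, add_mul, mul_assoc]
    exact add_mem (Ideal.mul_mem_right _ _ hk) (Ideal.mul_mem_left _ _ hu)
  clear hN hky
  induction N with
  | zero => simpa using key
  | succ N ih => exact ih (h.2.1 _ (by rwa [← mul_assoc, ← pow_succ']))

variable [IsLocalRing R] [IsNoetherianRing R]

theorem swap {J : Ideal R} {a b : R} {l : List R} (ha : a ∈ IsLocalRing.maximalIdeal R)
    (h : J.RegularMod (a :: b :: l)) : J.RegularMod (b :: a :: l) := by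
  obtain ⟨h1, h2, h3⟩ := h
  have hb : ∀ x, b * x ∈ J → x ∈ J := by
    let T : Ideal R := J.colon {b}
    have hT : ∀ u, u ∈ T ↔ b * u ∈ J := fun u => by
      simp [T, Submodule.mem_colon_singleton, mul_comm]
    have hle : T ≤ J := by
      refine Submodule.le_of_le_smul_of_le_jacobson_bot (I := IsLocalRing.maximalIdeal R)
        (IsNoetherian.noetherian T) (IsLocalRing.maximalIdeal_le_jacobson _) ?_
      intro u hu
      obtain ⟨j, hj, y, hy, rfl⟩ := Submodule.mem_sup.mp
        (h2 u (Ideal.mem_sup_left ((hT u).mp hu)))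
      obtain ⟨t, rfl⟩ := Ideal.mem_span_singleton'.mp hy
      refine add_mem (Ideal.mem_sup_left hj) (Ideal.mem_sup_right ?_)
      rw [mul_comm t a]
      refine Ideal.mul_mem_mul ha ((hT t).mpr (h1 _ ?_))
      rw [hT] at hu
      have := sub_mem hu (J.mul_mem_left b hj)
      convert this using 1
      ring
    exact fun x hx => hle ((hT x).mpr hx)
  refine ⟨hb, fun u hu => ?_, by rwa [sup_right_comm]⟩
  obtain ⟨j, hj, y, hy, hjy⟩ := Submodule.mem_sup.mp hu
  obtain ⟨v, rfl⟩ := Ideal.mem_span_singleton'.mp hy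
  have hv : b * v ∈ J ⊔ Ideal.span {a} := by
    have : b * v = a * u - j := by rw [← hjy]; ring
    rw [this]
    exact sub_mem (Ideal.mul_mem_right _ _ (Ideal.mem_sup_right (Ideal.mem_span_singleton_self a)))
      (Ideal.mem_sup_left hj)
  obtain ⟨j', hj', y', hy', rfl⟩ := Submodule.mem_sup.mp (h2 v hv)
  obtain ⟨v', rfl⟩ := Ideal.mem_span_singleton'.mp hy'
  have : u - b * v' ∈ J := by
    apply h1
    have : a * (u - b * v') = j + b * j' := by
      linear_combination -hjy
    rw [this]
    exact add_mem hj (J.mul_mem_left _ hj')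
  have h' : u = (u - b * v') + v' * b := by ring
  rw [h']
  exact add_mem (Ideal.mem_sup_left this)
    (Ideal.mem_sup_right (Ideal.mul_mem_left _ _ (Ideal.mem_span_singleton_self b)))

theorem perm {l l' : List R} (hp : l.Perm l') {J : Ideal R}
    (hl : ∀ a ∈ l, a ∈ IsLocalRing.maximalIdeal R) (h : J.RegularMod l) : J.RegularMod l' := by
  induction hp generalizing J with
  | nil => exact h
  | cons x _ ih => exact ⟨h.1, ih (fun a ha => hl a (by simp [ha])) h.2⟩
  | swap x y l => exact swap (hl y (by simp)) h
  | trans h1 h2 ih1 ih2 =>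
    exact ih2 (fun a ha => hl a (h1.mem_iff.mpr ha)) (ih1 hl h)

end Ideal.RegularMod

section LocalRing

open IsLocalRing

variable {R : Type*} [CommRing R] [IsLocalRing R] [IsNoetherianRing R]

theorem Ideal.maximalIdeal_le_radical_sup_span_of_notMem_minimalPrimes {K : Ideal R}
    {a z : R} (ham : a ∈ maximalIdeal R) (ha : maximalIdeal R ≤ (K ⊔ Ideal.span {a}).radical)
    (hz : ∀ P ∈ K.minimalPrimes, P ≠ maximalIdeal R → z ∉ P) :
    maximalIdeal R ≤ (K ⊔ Ideal.span {z}).radical := by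
  rw [Ideal.radical_eq_sInf]
  refine le_sInf fun Q ⟨hQ, hQp⟩ => ?_
  by_contra hne
  have hlt : Q < maximalIdeal R := lt_of_le_of_ne (le_maximalIdeal hQp.ne_top)
    fun h => hne h.ge
  have hKQ : K ≤ Q := le_sup_left.trans hQ
  have hspan : Ideal.span (insert a (K : Set R)) = K ⊔ Ideal.span {a} := by
    rw [Ideal.span_insert, Ideal.span_eq, sup_comm]
  have hm : maximalIdeal R ∈ (Ideal.span (insert a (K : Set R))).minimalPrimes := by
    rw [hspan]
    refine ⟨⟨inferInstance, sup_le (hKQ.trans hlt.le) (by simpa [Ideal.span_le] using ham)⟩,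
      fun P hP _ => ha.trans ((Ideal.radical_mono hP.2).trans hP.1.radical.le)⟩
  have := Ideal.mem_minimalPrimes_span_of_mem_minimalPrimes_span_insert hlt a _ hm K
    hKQ (fun x hx => Ideal.le_radical (Ideal.subset_span (by simp [hx])))
  rw [Ideal.span_eq] at this
  exact hz Q this hlt.ne (hQ (Ideal.mem_sup_right (Ideal.mem_span_singleton_self z)))

theorem Ideal.exists_maximalIdeal_le_radical_sup_span {K K' : Ideal R} {a a' : R}
    (ha : a ∈ maximalIdeal R) (ha' : a' ∈ maximalIdeal R)
    (h : maximalIdeal R ≤ (K ⊔ Ideal.span {a}).radical)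
    (h' : maximalIdeal R ≤ (K' ⊔ Ideal.span {a'}).radical) :
    ∃ z ∈ maximalIdeal R, maximalIdeal R ≤ (K ⊔ Ideal.span {z}).radical ∧
      maximalIdeal R ≤ (K' ⊔ Ideal.span {z}).radical := by
  let s : Set (Ideal R) := (K.minimalPrimes ∪ K'.minimalPrimes) \ {maximalIdeal R}
  have hs : s.Finite := ((Ideal.finite_minimalPrimes_of_isNoetherianRing R K).union
    (Ideal.finite_minimalPrimes_of_isNoetherianRing R K')).sdiff
  have hp : ∀ P ∈ s, P.IsPrime := by
    rintro P ⟨hP | hP, -⟩ <;> exact hP.1.1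
  have hns : ¬ ((maximalIdeal R : Set R) ⊆ ⋃ P ∈ s, (P : Set R)) := by
    intro hsub
    obtain ⟨P, hP, hle⟩ := (Ideal.subset_union_prime_finite hs (f := id) ⊥ ⊥
      fun P hP _ _ => hp P hP).mp hsub
    exact hP.2 (le_antisymm (le_maximalIdeal (hp P hP).ne_top) hle)
  obtain ⟨z, hz, hzs⟩ := Set.not_subset.mp hns
  simp only [Set.mem_iUnion, not_exists] at hzs
  exact ⟨z, hz,
    maximalIdeal_le_radical_sup_span_of_notMem_minimalPrimes ha h
      fun P hP hne => hzs P ⟨Or.inl hP, hne⟩,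
    maximalIdeal_le_radical_sup_span_of_notMem_minimalPrimes ha' h'
      fun P hP hne => hzs P ⟨Or.inr hP, hne⟩⟩

/-- In a Noetherian local ring, if one system of parameters modulo `J` is a regular sequence
modulo `J`, then every system of parameters modulo `J` of the same length is. -/
theorem Ideal.RegularMod.of_length_eq {xs vs : List R} (hlen : xs.length = vs.length) {J : Ideal R}
    (hxm : ∀ a ∈ xs, a ∈ maximalIdeal R) (hvm : ∀ a ∈ vs, a ∈ maximalIdeal R)
    (hx : maximalIdeal R ≤ (J ⊔ Ideal.ofList xs).radical)
    (hv : maximalIdeal R ≤ (J ⊔ Ideal.ofList vs).radical)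
    (h : J.RegularMod xs) : J.RegularMod vs := by
  induction xs generalizing vs J with
  | nil =>
    obtain rfl := List.length_eq_zero_iff.mp hlen.symm
    trivial
  | cons x xs ih =>
    match vs, hlen with
    | v :: vs, hlen =>
      have hxm' : ∀ a ∈ xs, a ∈ maximalIdeal R := fun a ha => hxm a (by simp [ha])
      have hvm' : ∀ a ∈ vs, a ∈ maximalIdeal R := fun a ha => hvm a (by simp [ha])
      rw [Ideal.ofList_cons, sup_comm (Ideal.span _), ← sup_assoc] at hx hv
      have hxx : x ∈ maximalIdeal R := hxm x (by simp)
      have hvv : v ∈ maximalIdeal R := hvm v (by simp)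
      obtain ⟨z, hz, hzx, hzv⟩ := Ideal.exists_maximalIdeal_le_radical_sup_span hxx hvv hx hv
      have h1 : J.RegularMod (xs ++ [z]) :=
        exchange_last (hzx hxx) (perm (List.perm_append_singleton x xs).symm hxm h)
      have h2 : J.RegularMod (z :: xs) := perm (List.perm_append_singleton z xs)
        (by simpa [or_imp, forall_and] using ⟨hxm', hz⟩) h1
      have h3 : (J ⊔ Ideal.span {z}).RegularMod vs :=
        ih (by simpa using hlen) hxm' hvm' (by rwa [sup_right_comm]) (by rwa [sup_right_comm]) h2.2
      have h4 : J.RegularMod (vs ++ [z]) := perm (List.perm_append_singleton z vs).symm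
        (by simpa [or_imp, forall_and] using ⟨hz, hvm'⟩) ⟨h2.1, h3⟩
      have h5 : J.RegularMod (vs ++ [v]) := exchange_last (hv hz) h4
      exact perm (List.perm_append_singleton v vs)
        (by simpa [or_imp, forall_and] using ⟨hvm', hvv⟩) h5

end LocalRing

theorem Ideal.RegularMod.map_of_isLocalization {R A : Type*} [CommRing R] [CommRing A] [Algebra R A]
    (M : Submonoid R) [IsLocalization M A] {J : Ideal R} {l : List R} (h : J.RegularMod l) :
    (J.map (algebraMap R A)).RegularMod (l.map (algebraMap R A)) := by
  induction l generalizing J with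
  | nil => trivial
  | cons a l ih =>
    refine ⟨fun x hx => ?_, ?_⟩
    · obtain ⟨⟨u, s⟩, hus⟩ := IsLocalization.surj M x
      have h1 : algebraMap R A (a * u) ∈ J.map (algebraMap R A) := by
        rw [map_mul, ← hus, ← mul_assoc]
        exact Ideal.mul_mem_right _ _ hx
      obtain ⟨t, ht, htu⟩ := (IsLocalization.algebraMap_mem_map_algebraMap_iff M A J _).mp h1
      have h2 : algebraMap R A u ∈ J.map (algebraMap R A) :=
        (IsLocalization.algebraMap_mem_map_algebraMap_iff M A J _).mpr
          ⟨t, ht, h.1 _ (by rwa [mul_left_comm])⟩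
      rw [← hus] at h2
      exact (Ideal.mul_unit_mem_iff_mem _ (IsLocalization.map_units A s)).mp h2
    · simpa [Ideal.map_sup, Ideal.map_span] using ih h.2

namespace MvPolynomial

attribute [local instance] weightedGradedAlgebra

section Graded

variable {σ k : Type*} [Field k] {w : σ → ℕ}

instance isPrime_ker_constantCoeff :
    (RingHom.ker (constantCoeff (R := k) (σ := σ))).IsPrime :=
  RingHom.ker_isPrime _

theorem weightedHomogeneousComponent_add_mul {p q : MvPolynomial σ k} {e : ℕ}
    (hq : IsWeightedHomogeneous w q e) (n : ℕ) :
    weightedHomogeneousComponent w (n + e) (p * q) = weightedHomogeneousComponent w n p * q := by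
  simp_rw [← weightedDecomposition.decompose'_apply]
  exact DirectSum.coe_decompose_mul_add_of_right_mem (weightedHomogeneousSubmodule k w) hq

theorem weightedHomogeneousComponent_mul_of_lt {p q : MvPolynomial σ k} {e n : ℕ}
    (hq : IsWeightedHomogeneous w q e) (hn : n < e) :
    weightedHomogeneousComponent w n (p * q) = 0 := by
  rw [← weightedDecomposition.decompose'_apply]
  exact DirectSum.coe_decompose_mul_of_right_mem_of_not_le (weightedHomogeneousSubmodule k w)
    hq hn.not_ge

theorem isHomogeneous_sup_span_singleton {J : Ideal (MvPolynomial σ k)}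
    (hJ : J.IsHomogeneous (weightedHomogeneousSubmodule k w)) {g : MvPolynomial σ k} {e : ℕ}
    (hg : IsWeightedHomogeneous w g e) :
    (J ⊔ Ideal.span {g}).IsHomogeneous (weightedHomogeneousSubmodule k w) :=
  hJ.sup (Ideal.homogeneous_span _ _ (by rintro x rfl; exact ⟨e, hg⟩))

/-- A homogeneous ideal is saturated with respect to polynomials with nonzero constant term. -/
theorem mem_of_mul_mem_of_constantCoeff_ne_zero (hw : ∀ i, w i ≠ 0) {J : Ideal (MvPolynomial σ k)}
    (hJ : J.IsHomogeneous (weightedHomogeneousSubmodule k w)) {s u : MvPolynomial σ k} {t : ℕ}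
    (hu : IsWeightedHomogeneous w u t) (hs : constantCoeff s ≠ 0) (h : s * u ∈ J) : u ∈ J := by
  have := weightedHomogeneousComponent_mem_of_mem k w hJ h (0 + t)
  rw [weightedHomogeneousComponent_add_mul hu, weightedHomogeneousComponent_zero _ hw] at this
  exact (Ideal.unit_mul_mem_iff_mem _ ((IsUnit.mk0 _ hs).map C)).mp this

theorem regularMod_of_map_localization (hw : ∀ i, w i ≠ 0) {A : Type*} [CommRing A]
    [Algebra (MvPolynomial σ k) A]
    [IsLocalization.AtPrime A (RingHom.ker (constantCoeff (R := k) (σ := σ)))]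
    {L : List (MvPolynomial σ k × ℕ)} (hL : ∀ a ∈ L, IsWeightedHomogeneous w a.1 a.2)
    {J : Ideal (MvPolynomial σ k)} (hJ : J.IsHomogeneous (weightedHomogeneousSubmodule k w))
    (h : (J.map (algebraMap _ A)).RegularMod ((L.map Prod.fst).map (algebraMap _ A))) :
    J.RegularMod (L.map Prod.fst) := by
  induction L generalizing J with
  | nil => trivial
  | cons a L ih =>
    obtain ⟨ha, hL⟩ := List.forall_mem_cons.mp hL
    refine ⟨fun x hx => ?_, ih hL (isHomogeneous_sup_span_singleton hJ ha) ?_⟩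
    · rw [mem_iff_weightedHomogeneousComponent_mem k w hJ]
      intro n
      have h1 := weightedHomogeneousComponent_mem_of_mem k w hJ hx (n + a.2)
      rw [mul_comm, weightedHomogeneousComponent_add_mul ha, mul_comm] at h1
      have h2 := h.1 (algebraMap _ A (weightedHomogeneousComponent w n x))
        (by rw [← map_mul]; exact Ideal.mem_map_of_mem _ h1)
      obtain ⟨s, hs, hsx⟩ := (IsLocalization.algebraMap_mem_map_algebraMap_iff
        (RingHom.ker (constantCoeff (R := k) (σ := σ))).primeCompl A J _).mp h2
      exact mem_of_mul_mem_of_constantCoeff_ne_zero hw hJ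
        (weightedHomogeneousComponent_isWeightedHomogeneous n x) hs hsx
    · simpa [Ideal.map_sup, Ideal.map_span] using h.2

theorem regularMod_span_X_map_X {l : List σ} (hl : l.Nodup) {s : Set σ} (hs : ∀ i ∈ l, i ∉ s) :
    (Ideal.span (X '' s : Set (MvPolynomial σ k))).RegularMod (l.map X) := by
  induction l generalizing s with
  | nil => trivial
  | cons a l ih =>
    classical
    obtain ⟨hal, hl⟩ := List.nodup_cons.mp hl
    obtain ⟨has, hs⟩ := List.forall_mem_cons.mp hs
    refine ⟨fun x hx => ?_, ?_⟩
    · rw [mem_ideal_span_X_image] at hx ⊢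
      intro m hm
      obtain ⟨i, hi, hne⟩ := hx (Finsupp.single a 1 + m) (by
        rw [mem_support_iff, coeff_X_mul]; exact mem_support_iff.mp hm)
      have hai : a ≠ i := fun h => has (h ▸ hi)
      exact ⟨i, hi, by simpa [hai] using hne⟩
    · rw [← Ideal.span_union, ← Set.image_singleton, ← Set.image_union]
      refine ih hl fun i hi => ?_
      rintro (h | rfl)
      exacts [hs i hi h, hal hi]

/-- If `xs` is a regular sequence and `L` is a list of weighted homogeneous elements of the same
length, both generating ideals with radical the irrelevant ideal, then `L` is a regular
sequence. -/
theorem regularMod_bot_of_length_eq [Finite σ] (hw : ∀ i, w i ≠ 0) {xs : List (MvPolynomial σ k)}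
    {L : List (MvPolynomial σ k × ℕ)} (hL : ∀ a ∈ L, IsWeightedHomogeneous w a.1 a.2)
    (hlen : xs.length = L.length)
    (hx : (Ideal.ofList xs).radical = RingHom.ker constantCoeff)
    (hv : (Ideal.ofList (L.map Prod.fst)).radical = RingHom.ker constantCoeff)
    (h : (⊥ : Ideal (MvPolynomial σ k)).RegularMod xs) :
    (⊥ : Ideal (MvPolynomial σ k)).RegularMod (L.map Prod.fst) := by
  let m : Ideal (MvPolynomial σ k) := RingHom.ker constantCoeff
  let A := Localization.AtPrime m
  have hmax : m.map (algebraMap _ A) = IsLocalRing.maximalIdeal A :=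
    Localization.AtPrime.map_eq_maximalIdeal
  have mem : ∀ l : List (MvPolynomial σ k), (Ideal.ofList l).radical = m →
      ∀ a ∈ l.map (algebraMap _ A), a ∈ IsLocalRing.maximalIdeal A := by
    intro l hl a ha
    obtain ⟨b, hb, rfl⟩ := List.mem_map.mp ha
    rw [← hmax]
    exact Ideal.mem_map_of_mem _ (hl.le (Ideal.le_radical (Ideal.subset_span hb)))
  have rad : ∀ l : List (MvPolynomial σ k), (Ideal.ofList l).radical = m →
      IsLocalRing.maximalIdeal A ≤
        ((⊥ : Ideal A) ⊔ Ideal.ofList (l.map (algebraMap _ A))).radical := by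
    intro l hl
    rw [← hmax, bot_sup_eq, ← Ideal.map_ofList]
    exact (Ideal.map_mono hl.ge).trans (Ideal.map_radical_le _)
  refine regularMod_of_map_localization (A := A) hw hL (Ideal.IsHomogeneous.bot _) ?_
  have h1 := h.map_of_isLocalization (A := A) m.primeCompl
  rw [Ideal.map_bot] at h1 ⊢
  exact h1.of_length_eq (by simpa using hlen) (mem _ hx) (mem _ hv) (rad _ hx) (rad _ hv)

theorem finiteDimensional_weightedHomogeneousSubmodule [Finite σ] (hw : ∀ i, w i ≠ 0) (n : ℕ) :
    FiniteDimensional k (weightedHomogeneousSubmodule k w n) :=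
  Module.Finite.iff_fg.mpr (weightedHomogeneousSubmodule_fg k w hw n)

theorem weightedHomogeneousSubmodule_add_inf_sup_span {J : Ideal (MvPolynomial σ k)}
    (hJ : J.IsHomogeneous (weightedHomogeneousSubmodule k w)) {g : MvPolynomial σ k} {e : ℕ}
    (hg : IsWeightedHomogeneous w g e) (n : ℕ) :
    weightedHomogeneousSubmodule k w (n + e) ⊓ (J ⊔ Ideal.span {g}).restrictScalars k =
      weightedHomogeneousSubmodule k w (n + e) ⊓ J.restrictScalars k ⊔
        (weightedHomogeneousSubmodule k w n).map (LinearMap.mulRight k g) := by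
  apply le_antisymm
  · rintro x ⟨hx, hxJ⟩
    obtain ⟨j, hj, y, hy, rfl⟩ := Submodule.mem_sup.mp hxJ
    obtain ⟨u, rfl⟩ := Ideal.mem_span_singleton'.mp hy
    rw [← weightedHomogeneousComponent_eq_self hx, map_add, weightedHomogeneousComponent_add_mul hg]
    exact Submodule.add_mem_sup
      ⟨weightedHomogeneousComponent_mem w j _, weightedHomogeneousComponent_mem_of_mem k w hJ hj _⟩
      ⟨_, weightedHomogeneousComponent_mem w u _, rfl⟩
  · refine sup_le (inf_le_inf_left _ fun x hx => Ideal.mem_sup_left hx) ?_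
    rintro _ ⟨u, hu, rfl⟩
    exact ⟨IsWeightedHomogeneous.mul hu hg,
      Ideal.mem_sup_right (Ideal.mul_mem_left _ _ (Ideal.mem_span_singleton_self g))⟩

theorem weightedHomogeneousSubmodule_inf_sup_span_of_lt {J : Ideal (MvPolynomial σ k)}
    (hJ : J.IsHomogeneous (weightedHomogeneousSubmodule k w)) {g : MvPolynomial σ k} {e : ℕ}
    (hg : IsWeightedHomogeneous w g e) {n : ℕ} (hn : n < e) :
    weightedHomogeneousSubmodule k w n ⊓ (J ⊔ Ideal.span {g}).restrictScalars k =
      weightedHomogeneousSubmodule k w n ⊓ J.restrictScalars k := by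
  refine le_antisymm ?_ (inf_le_inf_left _ fun x hx => Ideal.mem_sup_left hx)
  rintro x ⟨hx, hxJ⟩
  obtain ⟨j, hj, y, hy, rfl⟩ := Submodule.mem_sup.mp hxJ
  obtain ⟨u, rfl⟩ := Ideal.mem_span_singleton'.mp hy
  refine ⟨hx, ?_⟩
  rw [← weightedHomogeneousComponent_eq_self hx, map_add,
    weightedHomogeneousComponent_mul_of_lt hg hn, add_zero]
  exact weightedHomogeneousComponent_mem_of_mem k w hJ hj _

theorem finrank_weightedHomogeneousSubmodule_inf_sup_span [Finite σ] (hw : ∀ i, w i ≠ 0)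
    {J : Ideal (MvPolynomial σ k)}
    (hJ : J.IsHomogeneous (weightedHomogeneousSubmodule k w)) {g : MvPolynomial σ k} {e : ℕ}
    (hg : IsWeightedHomogeneous w g e) (hreg : ∀ x, g * x ∈ J → x ∈ J) (n : ℕ) :
    Module.finrank k ↥(weightedHomogeneousSubmodule k w (n + e) ⊓
        (J ⊔ Ideal.span {g}).restrictScalars k) +
      Module.finrank k ↥(weightedHomogeneousSubmodule k w n ⊓ J.restrictScalars k) =
    Module.finrank k ↥(weightedHomogeneousSubmodule k w (n + e) ⊓ J.restrictScalars k) +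
      Module.finrank k (weightedHomogeneousSubmodule k w n) := by
  rcases eq_or_ne g 0 with rfl | hg0
  · obtain rfl : J = ⊤ := (Ideal.eq_top_iff_one J).mpr (hreg 1 (by simp))
    rw [top_sup_eq, Submodule.restrictScalars_top, inf_top_eq, inf_top_eq]
  have := finiteDimensional_weightedHomogeneousSubmodule (k := k) hw n
  have := finiteDimensional_weightedHomogeneousSubmodule (k := k) hw (n + e)
  have hinj : Function.Injective (LinearMap.mulRight k g) := mul_left_injective₀ hg0
  have hinf : (weightedHomogeneousSubmodule k w (n + e) ⊓ J.restrictScalars k) ⊓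
      (weightedHomogeneousSubmodule k w n).map (LinearMap.mulRight k g) =
      (weightedHomogeneousSubmodule k w n ⊓ J.restrictScalars k).map
        (LinearMap.mulRight k g) := by
    ext x
    constructor
    · rintro ⟨⟨-, hx⟩, u, hu, rfl⟩
      exact ⟨u, ⟨hu, hreg u (by simpa [mul_comm] using hx)⟩, rfl⟩
    · rintro ⟨u, ⟨hu, huJ⟩, rfl⟩
      exact ⟨⟨IsWeightedHomogeneous.mul hu hg, J.mul_mem_right _ huJ⟩, u, hu, rfl⟩
  have key := Submodule.finrank_sup_add_finrank_inf_eq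
    (weightedHomogeneousSubmodule k w (n + e) ⊓ J.restrictScalars k)
    ((weightedHomogeneousSubmodule k w n).map (LinearMap.mulRight k g))
  rw [hinf, ← weightedHomogeneousSubmodule_add_inf_sup_span hJ hg,
    ← (Submodule.equivMapOfInjective _ hinj _).finrank_eq,
    ← (Submodule.equivMapOfInjective _ hinj _).finrank_eq] at key
  exact key

/-- The Hilbert series of `MvPolynomial σ k ⧸ J` for the grading with weights `w`. -/
noncomputable def hilbertSeries (w : σ → ℕ) (J : Ideal (MvPolynomial σ k)) : PowerSeries ℤ :=
  PowerSeries.mk fun n => (Module.finrank k (weightedHomogeneousSubmodule k w n) : ℤ) -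
    Module.finrank k ↥(weightedHomogeneousSubmodule k w n ⊓ J.restrictScalars k)

theorem hilbertSeries_sup_span [Finite σ] (hw : ∀ i, w i ≠ 0) {J : Ideal (MvPolynomial σ k)}
    (hJ : J.IsHomogeneous (weightedHomogeneousSubmodule k w)) {g : MvPolynomial σ k} {e : ℕ}
    (hg : IsWeightedHomogeneous w g e) (hreg : ∀ x, g * x ∈ J → x ∈ J) :
    hilbertSeries w (J ⊔ Ideal.span {g}) = hilbertSeries w J * (1 - PowerSeries.X ^ e) := by
  ext n
  rw [mul_sub, mul_one, map_sub, PowerSeries.coeff_mul_X_pow']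
  simp only [hilbertSeries, PowerSeries.coeff_mk]
  split_ifs with h
  · obtain ⟨n, rfl⟩ := Nat.exists_eq_add_of_le' h
    have := finrank_weightedHomogeneousSubmodule_inf_sup_span hw hJ hg hreg n
    zify at this
    rw [Nat.add_sub_cancel]
    linear_combination -this
  · rw [weightedHomogeneousSubmodule_inf_sup_span_of_lt hJ hg (not_le.mp h), sub_zero]

theorem hilbertSeries_sup_ofList [Finite σ] (hw : ∀ i, w i ≠ 0) {L : List (MvPolynomial σ k × ℕ)}
    (hL : ∀ a ∈ L, IsWeightedHomogeneous w a.1 a.2) {J : Ideal (MvPolynomial σ k)}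
    (hJ : J.IsHomogeneous (weightedHomogeneousSubmodule k w))
    (hreg : J.RegularMod (L.map Prod.fst)) :
    hilbertSeries w (J ⊔ Ideal.ofList (L.map Prod.fst)) =
      hilbertSeries w J * (L.map fun a => 1 - PowerSeries.X ^ a.2).prod := by
  induction L generalizing J with
  | nil => simp
  | cons a L ih =>
    obtain ⟨ha, hL⟩ := List.forall_mem_cons.mp hL
    rw [List.map_cons, Ideal.ofList_cons, ← sup_assoc,
      ih hL (isHomogeneous_sup_span_singleton hJ ha) hreg.2,
      hilbertSeries_sup_span hw hJ ha hreg.1, List.map_cons, List.prod_cons, mul_assoc]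

/-- The graded pieces of `MvPolynomial σ k ⧸ J`. -/
def GradedPiece (w : σ → ℕ) (J : Ideal (MvPolynomial σ k)) (t : ℕ) : Type _ :=
  weightedHomogeneousSubmodule k w t ⧸
    (J.restrictScalars k).comap (weightedHomogeneousSubmodule k w t).subtype

noncomputable instance (J : Ideal (MvPolynomial σ k)) (t : ℕ) : AddCommGroup (GradedPiece w J t) :=
  inferInstanceAs (AddCommGroup (_ ⧸ (J.restrictScalars k).comap
    (weightedHomogeneousSubmodule k w t).subtype))

noncomputable instance (J : Ideal (MvPolynomial σ k)) (t : ℕ) : Module k (GradedPiece w J t) :=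
  inferInstanceAs (Module k (_ ⧸ (J.restrictScalars k).comap
    (weightedHomogeneousSubmodule k w t).subtype))

/-- The projection from a graded piece of the polynomial ring. -/
noncomputable def GradedPiece.mkQ (w : σ → ℕ) (J : Ideal (MvPolynomial σ k)) (t : ℕ) :
    weightedHomogeneousSubmodule k w t →ₗ[k] GradedPiece w J t :=
  ((J.restrictScalars k).comap (weightedHomogeneousSubmodule k w t).subtype).mkQ

theorem GradedPiece.mkQ_surjective (J : Ideal (MvPolynomial σ k)) (t : ℕ) :
    Function.Surjective (GradedPiece.mkQ w J t) :=
  Submodule.mkQ_surjective _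

theorem GradedPiece.mkQ_eq_zero_iff {J : Ideal (MvPolynomial σ k)} {t : ℕ}
    {p : weightedHomogeneousSubmodule k w t} :
    GradedPiece.mkQ w J t p = 0 ↔ (p : MvPolynomial σ k) ∈ J :=
  Submodule.Quotient.mk_eq_zero _

theorem finrank_gradedPiece [Finite σ] (hw : ∀ i, w i ≠ 0) (J : Ideal (MvPolynomial σ k)) (t : ℕ) :
    (Module.finrank k (GradedPiece w J t) : ℤ) = PowerSeries.coeff t (hilbertSeries w J) := by
  have := finiteDimensional_weightedHomogeneousSubmodule (k := k) hw t
  have h1 := Submodule.finrank_quotient_add_finrank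
    ((J.restrictScalars k).comap (weightedHomogeneousSubmodule k w t).subtype)
  have h2 : Module.finrank k ((J.restrictScalars k).comap
      (weightedHomogeneousSubmodule k w t).subtype) =
      Module.finrank k ↥(weightedHomogeneousSubmodule k w t ⊓ J.restrictScalars k) := by
    rw [← Submodule.map_comap_subtype]
    exact (Submodule.equivSubtypeMap _ _).finrank_eq
  simp only [hilbertSeries, PowerSeries.coeff_mk]
  rw [h2] at h1
  replace h1 : Module.finrank k (GradedPiece w J t) + _ = _ := h1
  zify at h1
  linear_combination h1

/-- The projection to finitely many graded pieces of the quotient by `J`. -/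
noncomputable def toGradedPieces (w : σ → ℕ) (J : Ideal (MvPolynomial σ k)) (T : ℕ) :
    MvPolynomial σ k →ₗ[k] ∀ t : Fin T, GradedPiece w J t :=
  LinearMap.pi fun t => (GradedPiece.mkQ w J t).comp
    ((weightedHomogeneousComponent w (t : ℕ)).codRestrict _
      fun p => weightedHomogeneousComponent_mem w p _)

theorem toGradedPieces_surjective (J : Ideal (MvPolynomial σ k)) (T : ℕ) :
    Function.Surjective (toGradedPieces w J T) := by
  intro q
  choose p hp using fun t : Fin T => GradedPiece.mkQ_surjective J t (q t)
  refine ⟨∑ t, (p t : MvPolynomial σ k), ?_⟩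
  funext t
  rw [← hp t]
  refine congrArg (GradedPiece.mkQ w J t) (Subtype.ext ?_)
  rw [LinearMap.codRestrict_apply, map_sum, Finset.sum_eq_single t]
  · exact weightedHomogeneousComponent_eq_self (p t).2
  · intro b _ hb
    exact (p b).2.weightedHomogeneousComponent_ne _ fun h => hb (Fin.ext h.symm)
  · simp

theorem toGradedPieces_apply_eq_zero_iff {J : Ideal (MvPolynomial σ k)} {T : ℕ}
    {p : MvPolynomial σ k} :
    toGradedPieces w J T p = 0 ↔ ∀ t : Fin T, weightedHomogeneousComponent w (t : ℕ) p ∈ J := by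
  refine _root_.funext_iff.trans (forall_congr' fun t => ?_)
  exact GradedPiece.mkQ_eq_zero_iff

theorem ker_toGradedPieces {J : Ideal (MvPolynomial σ k)}
    (hJ : J.IsHomogeneous (weightedHomogeneousSubmodule k w)) {T : ℕ}
    (hT : ∀ t, T ≤ t → weightedHomogeneousSubmodule k w t ≤ J.restrictScalars k) :
    LinearMap.ker (toGradedPieces w J T) = J.restrictScalars k := by
  ext p
  rw [LinearMap.mem_ker, Submodule.restrictScalars_mem, toGradedPieces_apply_eq_zero_iff,
    mem_iff_weightedHomogeneousComponent_mem k w hJ]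
  refine ⟨fun h t => ?_, fun h t => h t⟩
  rcases le_or_gt T t with ht | ht
  · exact hT t ht (weightedHomogeneousComponent_mem w p t)
  · exact h ⟨t, ht⟩

theorem exists_linearEquiv_of_ker_eq {R M N P : Type*} [Ring R] [AddCommGroup M] [AddCommGroup N]
    [AddCommGroup P] [Module R M] [Module R N] [Module R P] {f : M →ₗ[R] N} {g : M →ₗ[R] P}
    (hf : Function.Surjective f) (hg : Function.Surjective g)
    (h : LinearMap.ker f = LinearMap.ker g) : Nonempty (N ≃ₗ[R] P) :=
  ⟨(f.quotKerEquivOfSurjective hf).symm ≪≫ₗ Submodule.quotEquivOfEq _ _ h ≪≫ₗ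
    g.quotKerEquivOfSurjective hg⟩

theorem finiteDimensional_gradedPiece [Finite σ] (hw : ∀ i, w i ≠ 0)
    (J : Ideal (MvPolynomial σ k)) (t : ℕ) : FiniteDimensional k (GradedPiece w J t) :=
  have := finiteDimensional_weightedHomogeneousSubmodule (k := k) hw t
  Module.Finite.of_surjective _ (GradedPiece.mkQ_surjective J t)

theorem nonempty_linearEquiv_gradedPieces {J : Ideal (MvPolynomial σ k)}
    (hJ : J.IsHomogeneous (weightedHomogeneousSubmodule k w)) {T : ℕ}
    (hT : ∀ t, T ≤ t → weightedHomogeneousSubmodule k w t ≤ J.restrictScalars k) :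
    Nonempty ((MvPolynomial σ k ⧸ J) ≃ₗ[k] ∀ t : Fin T, GradedPiece w J t) := by
  refine exists_linearEquiv_of_ker_eq (f := (Ideal.Quotient.mkₐ k J).toLinearMap)
    (g := toGradedPieces w J T) (Ideal.Quotient.mkₐ_surjective k J)
    (toGradedPieces_surjective J T) ?_
  rw [ker_toGradedPieces hJ hT]
  ext p
  exact Ideal.Quotient.eq_zero_iff_mem

theorem finrank_quotient_eq_sum [Finite σ] (hw : ∀ i, w i ≠ 0) {J : Ideal (MvPolynomial σ k)}
    (hJ : J.IsHomogeneous (weightedHomogeneousSubmodule k w)) {T : ℕ}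
    (hT : ∀ t, T ≤ t → weightedHomogeneousSubmodule k w t ≤ J.restrictScalars k) :
    FiniteDimensional k (MvPolynomial σ k ⧸ J) ∧
      (Module.finrank k (MvPolynomial σ k ⧸ J) : ℤ) =
        ∑ t ∈ Finset.range T, PowerSeries.coeff t (hilbertSeries w J) := by
  have hfin : ∀ t : Fin T, FiniteDimensional k (GradedPiece w J t) := fun t =>
    finiteDimensional_gradedPiece hw J t
  obtain ⟨E⟩ := nonempty_linearEquiv_gradedPieces hJ hT
  have : FiniteDimensional k (∀ t : Fin T, GradedPiece w J t) := Module.Finite.pi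
  refine ⟨Module.Finite.equiv E.symm, ?_⟩
  have h : Module.finrank k (∀ t : Fin T, GradedPiece w J t) =
      ∑ t : Fin T, Module.finrank k (GradedPiece w J t) := Module.finrank_pi_fintype k
  rw [E.finrank_eq, h, Nat.cast_sum, Finset.sum_range]
  exact Finset.sum_congr rfl fun t _ => finrank_gradedPiece hw J t

theorem exists_weightedHomogeneousSubmodule_le [Finite σ] {J : Ideal (MvPolynomial σ k)}
    (hJ : J.radical = RingHom.ker constantCoeff) :
    ∃ T, ∀ t, T ≤ t → weightedHomogeneousSubmodule k w t ≤ J.restrictScalars k := by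
  cases nonempty_fintype σ
  have hX : ∀ i : σ, ∃ N, (X i : MvPolynomial σ k) ^ N ∈ J := fun i =>
    hJ.ge (by simp [RingHom.mem_ker] : X i ∈ RingHom.ker (constantCoeff (R := k)))
  choose N hN using hX
  refine ⟨∑ i, N i * w i + 1, fun t ht p hp => ?_⟩
  rw [Submodule.restrictScalars_mem, p.as_sum]
  refine sum_mem fun m hm => ?_
  obtain ⟨i, hi⟩ : ∃ i, N i ≤ m i := by
    by_contra! hlt
    have hwt := hp (mem_support_iff.mp hm)
    rw [Finsupp.weight_apply, Finsupp.sum_fintype _ _ (by simp)] at hwt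
    have : ∑ i, m i • w i ≤ ∑ i, N i * w i :=
      Finset.sum_le_sum fun i _ => Nat.mul_le_mul_right _ (hlt i).le
    lia
  have : monomial m (coeff m p) = monomial (m - Finsupp.single i (N i)) (coeff m p) * X i ^ N i := by
    rw [X_pow_eq_monomial, monomial_mul, mul_one,
      tsub_add_cancel_of_le (Finsupp.single_le_iff.mpr hi)]
  rw [this]
  exact J.mul_mem_left _ (hN i)

open Polynomial in
/-- The Hilbert series of an Artinian graded quotient is a polynomial whose value at `1` is the
dimension of the quotient. -/
theorem exists_polynomial_eq_hilbertSeries [Finite σ] (hw : ∀ i, w i ≠ 0)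
    {J : Ideal (MvPolynomial σ k)}
    (hJ : J.IsHomogeneous (weightedHomogeneousSubmodule k w))
    (hrad : J.radical = RingHom.ker constantCoeff) :
    FiniteDimensional k (MvPolynomial σ k ⧸ J) ∧
    ∃ p : ℤ[X], (p : PowerSeries ℤ) = hilbertSeries w J ∧
      p.eval 1 = Module.finrank k (MvPolynomial σ k ⧸ J) := by
  obtain ⟨T, hT⟩ := exists_weightedHomogeneousSubmodule_le (w := w) hrad
  obtain ⟨hfin, hrank⟩ := finrank_quotient_eq_sum hw hJ hT
  refine ⟨hfin, PowerSeries.trunc T (hilbertSeries w J), ?_, ?_⟩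
  · ext t
    rw [Polynomial.coeff_coe, PowerSeries.coeff_trunc]
    split_ifs with h
    · rfl
    · rw [hilbertSeries, PowerSeries.coeff_mk, inf_eq_left.mpr (hT t (not_lt.mp h)), sub_self]
  · rw [hrank, ← Polynomial.eval₂_id, PowerSeries.eval₂_trunc_eq_sum_range]
    simp

end Graded

open Classical in
theorem isWeightedHomogeneous_of_aeval_two {σ : Type*} {w : σ → ℕ} {d : ℕ} {f : MvPolynomial σ ℂ}
    (h : aeval (fun i => C ((2 : ℂ) ^ w i) * X i) f = C ((2 : ℂ) ^ d) * f) :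
    IsWeightedHomogeneous w f d := by
  have key : ∀ p : MvPolynomial σ ℂ, ∀ s,
      coeff s (aeval (fun i => C ((2 : ℂ) ^ w i) * X i) p) =
        2 ^ Finsupp.weight w s * coeff s p := by
    intro p s
    induction p using MvPolynomial.induction_on' with
    | monomial u a =>
      have : aeval (fun i => C ((2 : ℂ) ^ w i) * X i) (monomial u a) =
          monomial u (2 ^ Finsupp.weight w u * a) := by
        rw [aeval_monomial, Finsupp.weight_apply, Finsupp.prod, Finsupp.sum]
        simp only [mul_pow, ← C_pow, Finset.prod_mul_distrib, ← pow_mul, ← map_prod]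
        rw [monomial_eq (a := _ * a), Finsupp.prod, algebraMap_eq, ← mul_assoc, ← C_mul,
          Finset.prod_pow_eq_pow_sum, mul_comm a]
        simp [mul_comm]
      rw [this, coeff_monomial, coeff_monomial]
      split_ifs with hu
      · rw [hu]
      · simp
    | add p q hp hq => rw [map_add, coeff_add, hp, hq, coeff_add, mul_add]
  intro s hs
  have hs' := key f s
  rw [h, coeff_C_mul] at hs'
  have h2 : ((2 ^ d : ℕ) : ℂ) = (2 ^ Finsupp.weight w s : ℕ) := by
    push_cast
    exact mul_right_cancel₀ hs hs'
  exact (Nat.pow_right_injective le_rfl (Nat.cast_injective h2)).symm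

theorem constantCoeff_eq_zero_of_isWeightedHomogeneous {σ R : Type*} [CommSemiring R] {w : σ → ℕ}
    {p : MvPolynomial σ R} {e : ℕ} (hp : IsWeightedHomogeneous w p e) (he : e ≠ 0) :
    constantCoeff p = 0 := by
  by_contra h
  exact he (by simpa using (hp h).symm)

theorem radical_span_eq_ker_constantCoeff {σ ι k : Type*} [Finite σ] [Field k] [IsAlgClosed k]
    {g : ι → MvPolynomial σ k} (h0 : ∀ i, constantCoeff (g i) = 0)
    (h : ∀ v : σ → k, (∀ i, eval v (g i) = 0) → v = 0) :
    (Ideal.span (Set.range g)).radical = RingHom.ker constantCoeff := by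
  have hz : zeroLocus k (Ideal.span (Set.range g)) = {0} := by
    ext v
    rw [mem_zeroLocus_iff, Set.mem_singleton_iff]
    constructor
    · intro hv
      refine h v fun i => ?_
      simpa [aeval_eq_eval] using hv _ (Ideal.subset_span ⟨i, rfl⟩)
    · rintro rfl p hp
      have : p ∈ RingHom.ker (constantCoeff (σ := σ) (R := k)) := by
        refine Ideal.span_le.mpr ?_ hp
        rintro _ ⟨i, rfl⟩
        exact h0 i
      simpa [aeval_eq_eval, RingHom.mem_ker, constantCoeff_eq] using this
  rw [← vanishingIdeal_zeroLocus_eq_radical (K := k), hz]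
  ext p
  simp [aeval_eq_eval, RingHom.mem_ker, constantCoeff_eq]

theorem finrank_quotient_ker_constantCoeff {σ k : Type*} [Field k] :
    Module.finrank k (MvPolynomial σ k ⧸ RingHom.ker (constantCoeff (σ := σ) (R := k))) = 1 := by
  have h : RingHom.ker (constantCoeff (σ := σ) (R := k)) =
      RingHom.ker (aeval (R := k) (0 : σ → k)) := by
    ext p
    simp [RingHom.mem_ker, constantCoeff_eq]
  rw [h, (Ideal.quotientKerAlgEquivOfSurjective (f := aeval (R := k) (0 : σ → k))
    fun a => ⟨C a, by simp⟩).toLinearEquiv.finrank_eq, Module.finrank_self]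

theorem span_range_X_eq_ker_constantCoeff {σ k : Type*} [Field k] :
    Ideal.span (Set.range (X : σ → MvPolynomial σ k)) = RingHom.ker constantCoeff := by
  ext p
  rw [← Set.image_univ, mem_ideal_span_X_image, RingHom.mem_ker, constantCoeff_eq]
  constructor
  · intro h
    by_contra hp
    obtain ⟨i, -, hi⟩ := h 0 (mem_support_iff.mpr hp)
    exact hi rfl
  · intro h m hm
    obtain ⟨i, hi⟩ := DFunLike.ne_iff.mp fun h0 : m = 0 => mem_support_iff.mp hm (h0 ▸ h)
    exact ⟨i, trivial, hi⟩

open Polynomial in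
theorem prod_one_sub_X_pow {ι : Type*} (s : Finset ι) (e : ι → ℕ) :
    ∏ i ∈ s, (1 - (Polynomial.X : ℤ[X]) ^ e i) =
      (1 - Polynomial.X) ^ s.card * ∏ i ∈ s, ∑ j ∈ Finset.range (e i), Polynomial.X ^ j := by
  rw [← Finset.prod_const, ← Finset.prod_mul_distrib]
  exact Finset.prod_congr rfl fun i _ => (mul_neg_geom_sum _ _).symm

open Polynomial in
theorem eval_one_mul_prod_eq {ι : Type*} [Fintype ι] {p q : ℤ[X]} {a b : ι → ℕ}
    (h : p * ∏ i, (1 - Polynomial.X ^ a i) = q * ∏ i, (1 - Polynomial.X ^ b i)) :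
    p.eval 1 * ∏ i, (a i : ℤ) = q.eval 1 * ∏ i, (b i : ℤ) := by
  have h0 : (1 - Polynomial.X : ℤ[X]) ^ (Finset.univ : Finset ι).card ≠ 0 :=
    pow_ne_zero _ fun h => by simpa using congrArg (Polynomial.eval 0) h
  rw [prod_one_sub_X_pow, prod_one_sub_X_pow, mul_left_comm, mul_left_comm q] at h
  simpa [Polynomial.eval_prod, Polynomial.eval_finsetSum] using
    congrArg (Polynomial.eval 1) (mul_left_cancel₀ h0 h)

theorem ofList_map_finRange {R : Type*} [CommRing R] {n : ℕ} (g : Fin n → R) (e : Fin n → ℕ) :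
    Ideal.ofList (((List.finRange n).map fun i => (g i, e i)).map Prod.fst) =
      Ideal.span (Set.range g) := by
  refine congrArg Ideal.span (Set.ext fun x => ?_)
  simp

theorem isHomogeneous_span_range {n : ℕ} {k : Type*} [Field k] {w e : Fin n → ℕ}
    {g : Fin n → MvPolynomial (Fin n) k} (hg : ∀ i, IsWeightedHomogeneous w (g i) (e i)) :
    (Ideal.span (Set.range g)).IsHomogeneous (weightedHomogeneousSubmodule k w) := by
  refine Ideal.homogeneous_span _ _ ?_
  rintro _ ⟨i, rfl⟩
  exact ⟨e i, hg i⟩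

theorem hilbertSeries_span_range {n : ℕ} {k : Type*} [Field k] {w e : Fin n → ℕ}
    (hw : ∀ i, w i ≠ 0) {g : Fin n → MvPolynomial (Fin n) k}
    (hg : ∀ i, IsWeightedHomogeneous w (g i) (e i))
    (hrad : (Ideal.span (Set.range g)).radical = RingHom.ker constantCoeff) :
    hilbertSeries w (Ideal.span (Set.range g)) =
      hilbertSeries w (⊥ : Ideal (MvPolynomial (Fin n) k)) * ∏ i, (1 - PowerSeries.X ^ e i) := by
  have hL : ∀ a ∈ (List.finRange n).map fun i => (g i, e i),
      IsWeightedHomogeneous w a.1 a.2 := by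
    intro a ha
    obtain ⟨i, -, rfl⟩ := List.mem_map.mp ha
    exact hg i
  have hX : (Ideal.ofList ((List.finRange n).map (X (R := k)))).radical =
      RingHom.ker constantCoeff := by
    have : Ideal.ofList ((List.finRange n).map (X (R := k))) = RingHom.ker constantCoeff := by
      rw [← span_range_X_eq_ker_constantCoeff, ← ofList_map_finRange X 0, List.map_map]
      rfl
    rw [this]
    exact (RingHom.ker_isPrime _).radical
  have hreg : (⊥ : Ideal (MvPolynomial (Fin n) k)).RegularMod ((List.finRange n).map X) := by
    simpa using regularMod_span_X_map_X (k := k) (List.nodup_finRange n) (s := ∅) (by simp)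
  have := hilbertSeries_sup_ofList hw hL (Ideal.IsHomogeneous.bot _)
    (regularMod_bot_of_length_eq hw hL (by simp) hX (by rw [ofList_map_finRange, hrad]) hreg)
  rw [ofList_map_finRange, bot_sup_eq] at this
  rw [this, Fin.prod_univ_def, List.map_map]
  rfl

theorem finrank_mul_prod_eq {n : ℕ} {k : Type*} [Field k] {w e : Fin n → ℕ} (hw : ∀ i, w i ≠ 0)
    {g : Fin n → MvPolynomial (Fin n) k} (hg : ∀ i, IsWeightedHomogeneous w (g i) (e i))
    (hrad : (Ideal.span (Set.range g)).radical = RingHom.ker constantCoeff) :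
    FiniteDimensional k (MvPolynomial (Fin n) k ⧸ Ideal.span (Set.range g)) ∧
      Module.finrank k (MvPolynomial (Fin n) k ⧸ Ideal.span (Set.range g)) * ∏ i, w i =
        ∏ i, e i := by
  have hX : ∀ i, IsWeightedHomogeneous w (X i : MvPolynomial (Fin n) k) (w i) := fun i =>
    isWeightedHomogeneous_X k w i
  have hradX : (Ideal.span (Set.range (X : Fin n → MvPolynomial (Fin n) k))).radical =
      RingHom.ker constantCoeff := by
    rw [span_range_X_eq_ker_constantCoeff]
    exact (RingHom.ker_isPrime _).radical
  obtain ⟨hfin, p, hp, hp1⟩ :=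
    exists_polynomial_eq_hilbertSeries hw (isHomogeneous_span_range hg) hrad
  obtain ⟨-, q, hq, hq1⟩ :=
    exists_polynomial_eq_hilbertSeries hw (isHomogeneous_span_range hX) hradX
  rw [hilbertSeries_span_range hw hg hrad] at hp
  rw [hilbertSeries_span_range hw hX hradX] at hq
  rw [span_range_X_eq_ker_constantCoeff, finrank_quotient_ker_constantCoeff] at hq1
  have h : p * ∏ i, (1 - Polynomial.X ^ w i) = q * ∏ i, (1 - Polynomial.X ^ e i) := by
    apply Polynomial.coe_injective ℤ
    have hcoe : ∀ a : Fin n → ℕ,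
        ((∏ i, (1 - Polynomial.X ^ a i) : Polynomial ℤ) : PowerSeries ℤ) =
          ∏ i, (1 - PowerSeries.X ^ a i) := fun a => by
      rw [← Polynomial.coeToPowerSeries.ringHom_apply, map_prod]
      simp
    rw [Polynomial.coe_mul, Polynomial.coe_mul, hp, hq, hcoe, hcoe, mul_right_comm]
  have h1 := eval_one_mul_prod_eq h
  rw [hp1, hq1, Nat.cast_one, one_mul] at h1
  exact ⟨hfin, by exact_mod_cast h1⟩

end MvPolynomial

/-- Milnor number of a weighted homogeneous isolated singularity: if `f` is
weighted homogeneous of positive integer weights `(w₁,…,wₙ)` and degree `d`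
with `wᵢ < d`, and the origin is its only critical point, then the Jacobian
algebra is finite-dimensional over `ℂ` of dimension `∏ᵢ (d - wᵢ)/wᵢ`. -/
theorem milnor_number_weighted_homogeneous (n : ℕ) (f : MvPolynomial (Fin n) ℂ)
    (w : Fin n → ℕ) (d : ℕ) (hw : ∀ i, 0 < w i) (hwd : ∀ i, w i < d)
    (hhom : ∀ l : ℂ, aeval (fun i : Fin n => C (l ^ w i) * X i) f = C (l ^ d) * f)
    (hcrit : ∀ v : Fin n → ℂ, (∀ i : Fin n, eval v (pderiv i f) = 0) → v = 0) :
    FiniteDimensional ℂ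
      (MvPolynomial (Fin n) ℂ ⧸ Ideal.span (Set.range fun i : Fin n => pderiv i f)) ∧
    (Module.finrank ℂ
        (MvPolynomial (Fin n) ℂ ⧸ Ideal.span (Set.range fun i : Fin n => pderiv i f)) : ℚ)
      = ∏ i : Fin n, ((d : ℚ) - (w i : ℚ)) / (w i : ℚ) := by
  have hf : IsWeightedHomogeneous w f d := isWeightedHomogeneous_of_aeval_two (hhom 2)
  have hg : ∀ i, IsWeightedHomogeneous w (pderiv i f) (d - w i) := fun i =>
    hf.pderiv (Nat.sub_add_cancel (hwd i).le)
  obtain ⟨hfin, hrank⟩ := finrank_mul_prod_eq (fun i => (hw i).ne') hg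
    (radical_span_eq_ker_constantCoeff (fun i =>
      constantCoeff_eq_zero_of_isWeightedHomogeneous (hg i) (Nat.sub_pos_of_lt (hwd i)).ne') hcrit)
  refine ⟨hfin, ?_⟩
  have hw0 : ∏ i, (w i : ℚ) ≠ 0 :=
    Finset.prod_ne_zero_iff.mpr fun i _ => Nat.cast_ne_zero.mpr (hw i).ne'
  rw [Finset.prod_div_distrib, eq_div_iff hw0]
  have h : ∀ i, (d : ℚ) - w i = (d - w i : ℕ) := fun i => (Nat.cast_sub (hwd i).le).symm
  simp only [h]
  exact_mod_cast hrank
end
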